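/- arXiv:1008.3470 — 2 statements merged into one kernel-verified Lean document; each statement's English description precedes it below -/
import Mathlib

section
/- Let G be a group acting 3-discontinuously and 2-cocompactly on a compactum T. Then G is finitely generated with respect to the stabilizers of the parabolic points: there exists a finite subset S ⊆ G such that G is generated by S together with the subgroups Stab_G p, where p ranges over the parabolic points of the action. -/
namespace RHG

/-- Triples with pairwise distinct components. -/
def distinct3 {X : Type*} : Set (X × X × X) :=
  {x | x.1 ≠ x.2.1 ∧ x.1 ≠ x.2.2 ∧ x.2.1 ≠ x.2.2}

/-- Pairs with distinct components. -/
def distinct2 {X : Type*} : Set (X × X) := {x | x.1 ≠ x.2}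

/-- The action `act` of `G` on `X` is 3-discontinuous: the induced action on the space of
(ordered) triples of pairwise distinct points is properly discontinuous. -/
def ThreeDisc {G X : Type*} [TopologicalSpace X] (act : G → X → X) : Prop :=
  ∀ K : Set (X × X × X), IsCompact K → K ⊆ distinct3 →
    Set.Finite {g : G |
      (((fun x : X × X × X => (act g x.1, act g x.2.1, act g x.2.2)) '' K) ∩ K).Nonempty}

/-- The action `act` of `G` on `X` is 2-cocompact: the action on the space of (ordered) pairs
of distinct points is cocompact. -/
def TwoCocompact {G X : Type*} [TopologicalSpace X] (act : G → X → X) : Prop :=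
  ∃ K : Set (X × X), IsCompact K ∧ K ⊆ distinct2 ∧
    ∀ x : X × X, x ∈ (distinct2 : Set (X × X)) → ∃ g : G, (act g x.1, act g x.2) ∈ K

/-- `ρ` is an action of the group `G` on `T` by homeomorphisms. -/
structure IsTopAction (G : Type*) [Group G] (T : Type*) [TopologicalSpace T]
    (ρ : G → T ≃ₜ T) : Prop where
  map_one : ρ 1 = Homeomorph.refl T
  map_mul : ∀ g h : G, ρ (g * h) = (ρ h).trans (ρ g)

/-- The stabilizer of a point for an action by homeomorphisms. -/
def actStab {G : Type*} [Group G] {T : Type*} [TopologicalSpace T]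
    (ρ : G → T ≃ₜ T) (hρ : IsTopAction G T ρ) (p : T) : Subgroup G where
  carrier := {g : G | ρ g p = p}
  one_mem' := by
    simp only [Set.mem_setOf_eq, hρ.map_one, Homeomorph.refl_apply, id_eq]
  mul_mem' := by
    intro a b ha hb
    simp only [Set.mem_setOf_eq] at *
    rw [hρ.map_mul, Homeomorph.trans_apply, hb, ha]
  inv_mem' := by
    intro a ha
    simp only [Set.mem_setOf_eq] at *
    have h1 : ρ (a⁻¹ * a) p = ρ a⁻¹ (ρ a p) := by
      rw [hρ.map_mul, Homeomorph.trans_apply]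
    rw [inv_mul_cancel, hρ.map_one, ha] at h1
    simpa using h1.symm

/-- A parabolic point: its stabilizer is infinite and it is the unique fixed point
of its stabilizer. -/
def IsParabolicPt {G : Type*} [Group G] {T : Type*} [TopologicalSpace T]
    (ρ : G → T ≃ₜ T) (hρ : IsTopAction G T ρ) (p : T) : Prop :=
  Set.Infinite ((actStab ρ hρ p : Set G)) ∧
    ∀ q : T, (∀ g ∈ actStab ρ hρ p, ρ g q = q) → q = p

/-- `T` contains at least three points. -/
def HasThreePts (T : Type*) : Prop := ∃ x y z : T, x ≠ y ∧ x ≠ z ∧ y ≠ z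

end RHG

namespace RHG

section aux
set_option linter.unusedSectionVars false
open Filter Topology

section cross
variable {G : Type*} [Group G] {T : Type*} [TopologicalSpace T] [CompactSpace T] [T2Space T]
  [MulAction G T] {I : Type*}

/-- The family `g` escapes to infinity in the discrete group. -/
def Esc (U : Ultrafilter I) (g : I → G) : Prop := ∀ c, ∀ᶠ i in (U : Filter I), g i ≠ c

/-- Convergence dynamics: repelling point `r`, attracting point `a`. -/
def Cross (U : Ultrafilter I) (g : I → G) (r a : T) : Prop :=
  ∀ (x : I → T) (X : T), Tendsto x U (𝓝 X) → X ≠ r → Tendsto (fun i => g i • x i) U (𝓝 a)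

lemma ult_lim (U : Ultrafilter I) (x : I → T) : ∃ X, Tendsto x U (𝓝 X) :=
  ⟨(U.map x).lim, (U.map x).le_nhds_lim⟩

lemma Esc.of_not {U : Ultrafilter I} {g : I → G} (h : ¬ Esc U g) :
    ∃ c, ∀ᶠ i in (U : Filter I), g i = c := by
  unfold Esc at h
  push Not at h
  exact h

lemma Esc.not_finite {U : Ultrafilter I} {g : I → G} (h : Esc U g) {F : Set G} (hF : F.Finite)
    (hg : ∀ᶠ i in (U : Filter I), g i ∈ F) : False := by
  have : ∀ᶠ i in (U : Filter I), ∀ c ∈ F, g i ≠ c := (eventually_all_finite hF).2 fun c _ => h c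
  obtain ⟨i, h1, h2⟩ := (this.and hg).exists
  exact h1 _ h2 rfl

lemma comb {T : Type*} (h3 : HasThreePts T) (Φ : T → T → Prop) (hl : ∀ x, ∃ y, Φ x y)
    (hr : ∀ y, ∃ x, Φ x y)
    (hm : ∀ x1 x2 x3 y1 y2 y3, Φ x1 y1 → Φ x2 y2 → Φ x3 y3 → x1 ≠ x2 → x1 ≠ x3 → x2 ≠ x3 →
      y1 ≠ y2 → y1 ≠ y3 → y2 ≠ y3 → False) :
    ∃ r a, ∀ x y, Φ x y → x = r ∨ y = a := by
  have third : ∀ p q : T, ∃ s, s ≠ p ∧ s ≠ q := by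
    obtain ⟨x, y, z, h1, h2, h3⟩ := h3
    intro p q
    by_contra! h
    have := h x
    have := h y
    have := h z
    rcases eq_or_ne x p with h4 | h4 <;> rcases eq_or_ne y p with h5 | h5 <;>
      rcases eq_or_ne z p with h6 | h6 <;> grind
  by_cases h2 : ∃ x1 y1 x2 y2, Φ x1 y1 ∧ Φ x2 y2 ∧ x1 ≠ x2 ∧ y1 ≠ y2
  · have key : ∀ x1 y1 x2 y2 x3, Φ x1 y1 → Φ x2 y2 → x1 ≠ x2 → y1 ≠ y2 → x3 ≠ x1 → x3 ≠ x2 →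
        Φ x3 y1 → ∃ r a, ∀ x y, Φ x y → x = r ∨ y = a := by
      intro x1 y1 x2 y2 x3 e1 e2 hx hy h31 h32 e3
      obtain ⟨y3, hy31, hy32⟩ := third y1 y2
      obtain ⟨x4, e4⟩ := hr y3
      have hx4 : x4 = x2 := by
        by_contra hne
        by_cases h : x4 = x1
        · subst h
          exact hm _ _ _ _ _ _ e3 e4 e2 h31 h32 hx hy31.symm hy hy32
        · exact hm _ _ _ _ _ _ e1 e4 e2 (Ne.symm h) hx hne hy31.symm hy hy32
      subst hx4
      refine ⟨x4, y1, fun x y e => ?_⟩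
      by_contra! hc
      obtain ⟨x', e', n1, n2⟩ : ∃ x', Φ x' y1 ∧ x' ≠ x ∧ x' ≠ x4 := by
        by_cases h : x = x1
        · exact ⟨x3, e3, h ▸ h31, h32⟩
        · exact ⟨x1, e1, Ne.symm h, hx⟩
      obtain ⟨y', f', m1, m2⟩ : ∃ y', Φ x4 y' ∧ y' ≠ y ∧ y' ≠ y1 := by
        by_cases h : y = y2
        · exact ⟨y3, e4, h ▸ hy32, hy31⟩
        · exact ⟨y2, e2, Ne.symm h, hy.symm⟩
      exact hm _ _ _ _ _ _ e e' f' n1.symm hc.1 n2 hc.2 m1.symm m2.symm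
    obtain ⟨x1, y1, x2, y2, e1, e2, hx, hy⟩ := h2
    obtain ⟨x3, h31, h32⟩ := third x1 x2
    obtain ⟨y, e⟩ := hl x3
    by_cases c1 : y = y1
    · subst c1
      exact key _ _ _ _ _ e1 e2 hx hy h31 h32 e
    · by_cases c2 : y = y2
      · subst c2
        exact key _ _ _ _ _ e2 e1 hx.symm hy.symm h32 h31 e
      · exact (hm _ _ _ _ _ _ e1 e2 e hx h31.symm h32.symm hy (Ne.symm c1) (Ne.symm c2)).elim
  · push Not at h2
    obtain ⟨x, -⟩ := h3
    obtain ⟨y, e⟩ := hl x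
    refine ⟨x, y, fun x' y' e' => ?_⟩
    by_contra! hc
    exact hc.2 (h2 _ _ _ _ e e' hc.1.symm).symm

lemma isOpen_distinct3 : IsOpen (distinct3 : Set (T × T × T)) := by
  unfold distinct3
  refine (isOpen_ne_fun ?_ ?_).inter ((isOpen_ne_fun ?_ ?_).inter (isOpen_ne_fun ?_ ?_)) <;> fun_prop

lemma exists_cross (h3 : HasThreePts T) (h3d : ThreeDisc fun (g : G) (x : T) => g • x)
    (U : Ultrafilter I) (g : I → G) (hg : Esc U g) : ∃ r a : T, Cross U g r a := by
  suffices hs : ∃ r a, ∀ X Y, (∃ x : I → T, Tendsto x U (𝓝 X) ∧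
      Tendsto (fun i => g i • x i) U (𝓝 Y)) → X = r ∨ Y = a by
    obtain ⟨r, a, h⟩ := hs
    refine ⟨r, a, fun x X hx hX => ?_⟩
    obtain ⟨Y, hY⟩ := ult_lim U (fun i => g i • x i)
    rcases h X Y ⟨x, hx, hY⟩ with h | h
    · exact (hX h).elim
    · exact h ▸ hY
  apply comb h3
  · intro X
    obtain ⟨Y, hY⟩ := ult_lim U (fun i => g i • X)
    exact ⟨Y, _, tendsto_const_nhds, hY⟩
  · intro Y
    obtain ⟨X, hX⟩ := ult_lim U (fun i => (g i)⁻¹ • Y)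
    refine ⟨X, _, hX, ?_⟩
    simp only [smul_inv_smul]
    exact tendsto_const_nhds
  · rintro X1 X2 X3 Y1 Y2 Y3 ⟨x1, a1, b1⟩ ⟨x2, a2, b2⟩ ⟨x3, a3, b3⟩ n12 n13 n23 m12 m13 m23
    obtain ⟨K, hK, hXK, hKs⟩ := exists_compact_subset (isOpen_distinct3 (T := T))
      (show (X1, X2, X3) ∈ distinct3 from ⟨n12, n13, n23⟩)
    obtain ⟨L, hL, hYL, hLs⟩ := exists_compact_subset (isOpen_distinct3 (T := T))
      (show (Y1, Y2, Y3) ∈ distinct3 from ⟨m12, m13, m23⟩)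
    have hfin := h3d (K ∪ L) (hK.union hL) (Set.union_subset hKs hLs)
    refine hg.not_finite hfin ?_
    have t1 := (a1.prodMk_nhds (a2.prodMk_nhds a3)).eventually (mem_interior_iff_mem_nhds.1 hXK)
    have t2 := (b1.prodMk_nhds (b2.prodMk_nhds b3)).eventually (mem_interior_iff_mem_nhds.1 hYL)
    filter_upwards [t1, t2] with i h1 h2
    exact ⟨_, ⟨_, Or.inl h1, rfl⟩, Or.inr h2⟩

lemma Cross.inv {U : Ultrafilter I} {g : I → G} {r a : T} (h : Cross U g r a) :
    Cross U (fun i => (g i)⁻¹) a r := by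
  intro x X hx hX
  obtain ⟨Y, hY⟩ := ult_lim U (fun i => (g i)⁻¹ • x i)
  by_cases hr : Y = r
  · exact hr ▸ hY
  · have := h _ _ hY hr
    simp only [smul_inv_smul] at this
    exact (hX (tendsto_nhds_unique hx this)).elim

lemma Cross.unif {U : Ultrafilter I} {g : I → G} {r a : T} (h : Cross U g r a) {N M : Set T}
    (hN : N ∈ 𝓝 r) (hM : M ∈ 𝓝 a) : ∀ᶠ i in (U : Filter I), ∀ z, z ∈ N ∨ g i • z ∈ M := by
  by_contra hc
  have hc' := Ultrafilter.eventually_not.2 hc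
  push Not at hc'
  have : ∀ i, ∃ z : T, (∃ z : T, z ∉ N ∧ g i • z ∉ M) → (z ∉ N ∧ g i • z ∉ M) := by
    intro i
    by_cases hi : ∃ z : T, z ∉ N ∧ g i • z ∉ M
    · exact ⟨hi.choose, fun _ => hi.choose_spec⟩
    · exact ⟨r, fun h => (hi h).elim⟩
  choose z hz using this
  obtain ⟨Z, hZ⟩ := ult_lim U z
  have hZr : Z ≠ r := by
    rintro rfl
    obtain ⟨i, h1, h2⟩ := ((hZ.eventually hN).and hc').exists
    exact (hz i h2).1 h1
  obtain ⟨i, h1, h2⟩ := (((h z Z hZ hZr).eventually hM).and hc').exists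
  exact (hz i h2).2 h1

lemma Cross.smul [ContinuousConstSMul G T] {U : Ultrafilter I} {g : I → G} {r a : T}
    (h : Cross U g r a) (m : G) : Cross U (fun i => m * g i) r (m • a) := by
  intro x X hx hX
  simp only [mul_smul]
  exact (h x X hx hX).const_smul m

/-- Auxiliary entourages attached to a compact fundamental set `K0` of pairs. -/
structure Good (G : Type*) [Group G] {T : Type*} [TopologicalSpace T] [MulAction G T]
    (v w K0 : Set (T × T)) : Prop where
  v_open : IsOpen v
  v_symm : ∀ a b, (a, b) ∈ v → (b, a) ∈ v
  v_refl : ∀ a, (a, a) ∈ v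
  K0_closed : IsClosed K0
  K0_cov : ∀ x y : T, x ≠ y → ∃ g : G, (g • x, g • y) ∈ K0
  K0_int : ∀ p ∈ K0, vᶜ ∈ 𝓝 p
  K0_tri : ∀ a b c, (a, c) ∈ K0 → (a, b) ∉ v ∨ (b, c) ∉ v
  w_nhds : ∀ p, w ∈ 𝓝 (p, p)
  w_symm : ∀ a b, (a, b) ∈ w → (b, a) ∈ w
  w_v : ∀ a b c, (a, b) ∈ w → (b, c) ∈ w → (a, c) ∈ v
  w_cl : ∀ p, p ∉ v → wᶜ ∈ 𝓝 p
  w_three : ∃ z1 z2 z3 : T, ∀ c, ¬ ((z1, c) ∈ w ∧ (z2, c) ∈ w) ∧ ¬ ((z1, c) ∈ w ∧ (z3, c) ∈ w) ∧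
    ¬ ((z2, c) ∈ w ∧ (z3, c) ∈ w)

/-- `g` precedes `h` on the way from `x` to `y`. -/
def Lt (w : Set (T × T)) (x y : T) (g h : G) : Prop :=
  ∀ z : T, (h⁻¹ • z, h⁻¹ • x) ∈ w ∨ (g⁻¹ • z, g⁻¹ • y) ∈ w

/-- `g` lies near the line between `x` and `y`. -/
def Pr (v : Set (T × T)) (x y : T) (g : G) : Prop := (g⁻¹ • x, g⁻¹ • y) ∉ v

variable {v w K0 : Set (T × T)}

lemma Good.K0_ne (hG : Good G v w K0) {a b : T} (h : (a, b) ∈ K0) : a ≠ b := by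
  rintro rfl
  exact mem_of_mem_nhds (hG.K0_int _ h) (hG.v_refl a)

lemma Good.v_ne (hG : Good G v w K0) {a b : T} (h : (a, b) ∉ v) : a ≠ b := by
  rintro rfl
  exact h (hG.v_refl a)

lemma Pr.symm (hG : Good G v w K0) {x y : T} {g : G} (h : Pr v x y g) : Pr v y x g :=
  fun h' => h (hG.v_symm _ _ h')

lemma Pr.ne (hG : Good G v w K0) {x y : T} {g : G} (h : Pr v x y g) : x ≠ y := by
  rintro rfl
  exact h (hG.v_refl _)

lemma Lt.trans (hG : Good G v w K0) {x y : T} {g h k : G} (hh : Pr v x y h)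
    (h1 : Lt w x y g h) (h2 : Lt w x y h k) : Lt w x y g k := by
  intro z
  rcases h1 z with a | a
  · rcases h2 z with b | b
    · exact Or.inl b
    · exact (hh (hG.w_v _ _ _ (hG.w_symm _ _ a) b)).elim
  · exact Or.inr a

lemma Lt.irrefl (hG : Good G v w K0) {x y : T} {g : G} : ¬ Lt w x y g g := by
  intro h
  obtain ⟨z1, z2, z3, hz⟩ := hG.w_three
  have h1 := h (g • z1)
  have h2 := h (g • z2)
  have h3 := h (g • z3)
  simp only [inv_smul_smul] at h1 h2 h3
  have a := hz (g⁻¹ • x)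
  have b := hz (g⁻¹ • y)
  tauto

/-- the criterion for the order along an ultrafilter -/
lemma Lt.of_cross (hG : Good G v w K0) {U : Ultrafilter I} {g h : I → G} {x y : I → T} {r a : T}
    (hc : Cross U (fun i => (g i)⁻¹ * h i) r a) (hy : Tendsto (fun i => (g i)⁻¹ • y i) U (𝓝 a))
    (hx : Tendsto (fun i => (h i)⁻¹ • x i) U (𝓝 r)) :
    ∀ᶠ i in (U : Filter I), Lt w (x i) (y i) (g i) (h i) := by
  obtain ⟨N, N2, hNo, hrN, hNo2, hrN2, hNw⟩ := mem_nhds_prod_iff'.1 (hG.w_nhds r)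
  obtain ⟨M, M2, hMo, haM, hMo2, haM2, hMw⟩ := mem_nhds_prod_iff'.1 (hG.w_nhds a)
  filter_upwards [hc.unif (hNo.mem_nhds hrN) (hMo.mem_nhds haM), hy.eventually (hMo2.mem_nhds haM2),
    hx.eventually (hNo2.mem_nhds hrN2)] with i h1 h2 h3
  intro z
  rcases h1 ((h i)⁻¹ • z) with h | h
  · exact Or.inl (hNw ⟨h, h3⟩)
  · rw [smul_smul, mul_assoc, mul_inv_cancel, mul_one] at h
    exact Or.inr (hMw ⟨h, h2⟩)

/-- two distinct test points among three, avoiding `X` -/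
lemma Good.two (hG : Good G v w K0) {U : Ultrafilter I} {y : I → T} {X : T}
    (h : ∀ z, z ≠ X → ∀ᶠ i in (U : Filter I), (z, y i) ∈ w) : False := by
  obtain ⟨z1, z2, z3, hz⟩ := hG.w_three
  have key : ∀ a b : T, a ≠ X → b ≠ X → (∀ c, ¬ ((a, c) ∈ w ∧ (b, c) ∈ w)) → False := by
    intro a b ha hb hab
    obtain ⟨i, hi⟩ := ((h a ha).and (h b hb)).exists
    exact hab _ hi
  have self : ∀ a, (a, a) ∈ w := fun a => mem_of_mem_nhds (hG.w_nhds a)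
  have d12 : z1 ≠ z2 := by
    rintro rfl
    exact (hz z1).1 ⟨self _, self _⟩
  have d13 : z1 ≠ z3 := by
    rintro rfl
    exact (hz z1).2.1 ⟨self _, self _⟩
  have d23 : z2 ≠ z3 := by
    rintro rfl
    exact (hz z2).2.2 ⟨self _, self _⟩
  by_cases h1 : z1 = X
  · subst h1
    exact key z2 z3 d12.symm d13.symm fun c => (hz c).2.2
  · by_cases h2 : z2 = X
    · subst h2
      exact key z1 z3 d12 d23.symm fun c => (hz c).2.1
    · exact key z1 z2 h1 h2 fun c => (hz c).1

lemma lim_not_v (hG : Good G v w K0) {U : Ultrafilter I} {x y : I → T} {X Y : T}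
    (hx : Tendsto x U (𝓝 X)) (hy : Tendsto y U (𝓝 Y)) (h : ∀ᶠ i in (U : Filter I), (x i, y i) ∉ v) :
    (X, Y) ∉ v :=
  hG.v_open.isClosed_compl.mem_of_tendsto (hx.prodMk_nhds hy) h

/-- Along an escaping family `g` with `1, g ∈ P(x,y)`, the position of the attracting point. -/
lemma pos {U : Ultrafilter I} {g : I → G} {x y : I → T} {r a X Y X' Y' : T}
    (hc : Cross U g r a) (hx : Tendsto x U (𝓝 X)) (hy : Tendsto y U (𝓝 Y))
    (hx' : Tendsto (fun i => (g i)⁻¹ • x i) U (𝓝 X'))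
    (hy' : Tendsto (fun i => (g i)⁻¹ • y i) U (𝓝 Y'))
    (h1 : X ≠ Y) (h2 : X' ≠ Y') : (a = Y ∧ r = X') ∨ (a = X ∧ r = Y') := by
  have e1 : X ≠ a → X' = r := fun h => tendsto_nhds_unique hx' (hc.inv _ _ hx h)
  have e2 : Y ≠ a → Y' = r := fun h => tendsto_nhds_unique hy' (hc.inv _ _ hy h)
  grind

/-- If moreover `1 < g`, then the attracting point is `lim y`. -/
lemma not_bad_right (hG : Good G v w K0) {U : Ultrafilter I} {g : I → G} {x y : I → T}
    {r a X' : T} (hc : Cross U g r a) (hx' : Tendsto (fun i => (g i)⁻¹ • x i) U (𝓝 X'))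
    (h2 : (r, X') ∉ v) (hlt : ∀ᶠ i in (U : Filter I), Lt w (x i) (y i) 1 (g i)) : False := by
  refine hG.two (U := U) (y := y) (X := a) fun z hz => ?_
  have t := (hc.inv _ _ (tendsto_const_nhds (x := z)) hz).prodMk_nhds hx'
  filter_upwards [t.eventually (hG.w_cl _ h2), hlt] with i h1 h2
  rcases h2 z with h | h
  · exact (h1 h).elim
  · simpa using h

lemma not_bad_left (hG : Good G v w K0) {U : Ultrafilter I} {g : I → G} {x y : I → T} {k : G}
    {r a Y' : T} (hc : Cross U g r a) (hy' : Tendsto (fun i => (g i)⁻¹ • y i) U (𝓝 Y'))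
    (h2 : (r, Y') ∉ v) (hlt : ∀ᶠ i in (U : Filter I), Lt w (x i) (y i) (g i) k) : False := by
  refine hG.two (U := U) (y := fun i => k⁻¹ • x i) (X := k⁻¹ • a) fun z hz => ?_
  have hz' : k • z ≠ a := by
    rintro rfl
    simp at hz
  have t := (hc.inv _ _ (tendsto_const_nhds (x := k • z)) hz').prodMk_nhds hy'
  filter_upwards [t.eventually (hG.w_cl _ h2), hlt] with i h1 h2
  rcases h2 (k • z) with h | h
  · simpa using h
  · exact (h1 h).elim

lemma Lt.smul_iff {x y : T} {g h : G} (m : G) :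
    Lt w (m • x) (m • y) (m * g) (m * h) ↔ Lt w x y g h := by
  unfold Lt
  constructor
  · intro H z
    have := H (m • z)
    simpa [mul_smul] using this
  · intro H z
    have := H (m⁻¹ • z)
    simpa [mul_smul] using this

lemma Pr.smul_iff {x y : T} {g : G} (m : G) : Pr v (m • x) (m • y) (m * g) ↔ Pr v x y g := by
  unfold Pr
  simp [mul_smul]

lemma exists_free_ultrafilter {s : Set G} (hs : s.Infinite) :
    ∃ U : Ultrafilter s, Esc U (fun i : s => (i : G)) := by
  have := hs.to_subtype
  refine ⟨Ultrafilter.of cofinite, fun c => Ultrafilter.of_le cofinite ?_⟩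
  have : {i : s | (i : G) = c}.Finite :=
    Set.Finite.preimage Subtype.val_injective.injOn (Set.finite_singleton c)
  exact this.compl_mem_cofinite

variable [ContinuousConstSMul G T]

/-- intervals are finite -/
lemma interval_finite (h3 : HasThreePts T) (h3d : ThreeDisc fun (g : G) (x : T) => g • x)
    (hG : Good G v w K0) {x y : T} (hxy : x ≠ y) (g k : G) :
    {h : G | Pr v x y h ∧ Lt w x y g h ∧ Lt w x y h k}.Finite := by
  by_contra hinf
  -- reduce to `g = 1`
  wlog hg : g = 1 generalizing x y g k
  · refine this (x := g⁻¹ • x) (y := g⁻¹ • y) (by simpa using hxy) 1 (g⁻¹ * k) ?_ rfl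
    intro hfin
    apply hinf
    have := hfin.image (fun h => g * h)
    refine this.subset ?_
    rintro h ⟨a, b, c⟩
    refine ⟨g⁻¹ * h, ⟨(Pr.smul_iff _).2 a, ?_, (Lt.smul_iff _).2 c⟩, by simp⟩
    have := (Lt.smul_iff (w := w) g⁻¹).2 b
    simpa using this
  subst hg
  obtain ⟨U, hU⟩ := exists_free_ultrafilter hinf
  obtain ⟨r, a, hc⟩ := exists_cross h3 h3d U _ hU
  obtain ⟨X', hX'⟩ := ult_lim U (fun i => (i : G)⁻¹ • x)
  obtain ⟨Y', hY'⟩ := ult_lim U (fun i => (i : G)⁻¹ • y)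
  have hv : (X', Y') ∉ v := lim_not_v hG hX' hY' (Eventually.of_forall fun i => i.2.1)
  rcases pos hc (tendsto_const_nhds (x := x)) (tendsto_const_nhds (x := y)) hX' hY' hxy
    (hG.v_ne hv) with ⟨rfl, rfl⟩ | ⟨rfl, rfl⟩
  · exact not_bad_left hG hc hY' hv (x := fun _ => x) (k := k)
      (Eventually.of_forall fun i => i.2.2.2)
  · exact not_bad_right hG hc hX' (fun h => hv (hG.v_symm _ _ h)) (y := fun _ => y)
      (Eventually.of_forall fun i => i.2.2.1)

/-- totality modulo a finite set -/
lemma total (h3 : HasThreePts T) (h3d : ThreeDisc fun (g : G) (x : T) => g • x)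
    (hG : Good G v w K0) :
    {k : G | ∃ x y : T, Pr v x y (1 : G) ∧ Pr v x y k ∧ ¬ Lt w x y 1 k ∧ ¬ Lt w x y k 1}.Finite := by
  by_contra hinf
  obtain ⟨U, hU⟩ := exists_free_ultrafilter hinf
  obtain ⟨r, a, hc⟩ := exists_cross h3 h3d U _ hU
  have hch := fun i : {k : G | ∃ x y : T, Pr v x y (1 : G) ∧ Pr v x y k ∧ ¬ Lt w x y 1 k ∧
    ¬ Lt w x y k 1} => i.2
  choose x y h1 h2 h3 h4 using hch
  obtain ⟨X, hX⟩ := ult_lim U x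
  obtain ⟨Y, hY⟩ := ult_lim U y
  obtain ⟨X', hX'⟩ := ult_lim U (fun i => (i : G)⁻¹ • x i)
  obtain ⟨Y', hY'⟩ := ult_lim U (fun i => (i : G)⁻¹ • y i)
  have hv : (X, Y) ∉ v := lim_not_v hG hX hY (Eventually.of_forall fun i => by
    simpa [Pr] using h1 i)
  have hv' : (X', Y') ∉ v := lim_not_v hG hX' hY' (Eventually.of_forall fun i => h2 i)
  rcases pos hc hX hY hX' hY' (hG.v_ne hv) (hG.v_ne hv') with ⟨rfl, rfl⟩ | ⟨rfl, rfl⟩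
  · obtain ⟨i, hi⟩ := (Lt.of_cross hG (U := U) (g := fun _ => (1 : G)) (h := fun i => (i.1 : G)) (x := x)
      (y := y) (by simpa using hc) (by simpa using hY) hX').exists
    exact h3 i hi
  · obtain ⟨i, hi⟩ := (Lt.of_cross hG (U := U) (h := fun _ => (1 : G)) (g := fun i => (i.1 : G)) (x := x)
      (y := y) (by simpa using hc.inv) hY' (by simpa using hX)).exists
    exact h4 i hi

/-- A family of consecutive pairs `1 < g` on the lines from `x` to `y`. -/
structure GapSeq (v w : Set (T × T)) (g : I → G) (x y : I → T) : Prop where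
  one : ∀ i, (x i, y i) ∉ v
  pr : ∀ i, Pr v (x i) (y i) (g i)
  lt : ∀ i, Lt w (x i) (y i) 1 (g i)
  gap : ∀ i h, Pr v (x i) (y i) h → Lt w (x i) (y i) 1 h → Lt w (x i) (y i) h (g i) → False

lemma Lt.swap {x y : T} {g h : G} (H : Lt w x y g h) : Lt w y x h g := fun z => (H z).symm

lemma GapSeq.swap (hG : Good G v w K0) {g : I → G} {x y : I → T} (hs : GapSeq v w g x y) :
    GapSeq v w (fun i => (g i)⁻¹) (fun i => (g i)⁻¹ • y i) (fun i => (g i)⁻¹ • x i) where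
  one i h := hs.pr i (hG.v_symm _ _ h)
  pr i := by
    have h := (hs.one i)
    intro h'
    simp only [inv_inv, smul_inv_smul] at h'
    exact h (hG.v_symm _ _ h')
  lt i := by
    have := (Lt.smul_iff (w := w) (g i)⁻¹).2 (hs.lt i).swap
    simpa using this
  gap i h h1 h2 h3 := by
    have a1 := (Pr.smul_iff (v := v) (g i)).2 h1
    have a2 := (Lt.smul_iff (w := w) (g i)).2 h2
    have a3 := (Lt.smul_iff (w := w) (g i)).2 h3
    simp only [smul_inv_smul, mul_inv_cancel, mul_one] at a1 a2 a3
    exact hs.gap i (g i * h) (a1.symm hG) a3.swap a2.swap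

lemma nonconical (hG : Good G v w K0) {U : Ultrafilter I} {g : I → G} {x y : I → T} {r p X : T}
    (hs : GapSeq v w g x y) (hc : Cross U g r p) (hx : Tendsto x U (𝓝 X)) (hXp : X ≠ p)
    (hy : Tendsto y U (𝓝 p)) (hx' : Tendsto (fun i => (g i)⁻¹ • x i) U (𝓝 r))
    {k : I → G} {c : T} (hk : Cross U k p c) : Tendsto (fun i => k i • p) U (𝓝 c) := by
  obtain ⟨b, hb⟩ := ult_lim U (fun i => k i • p)
  by_cases hbc : b = c
  · exact hbc ▸ hb
  exfalso
  -- normalize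
  obtain ⟨m, hm⟩ := hG.K0_cov c b (Ne.symm hbc)
  have hk2 := hk.smul m
  have hb2 : Tendsto (fun i => (m * k i) • p) U (𝓝 (m • b)) := by
    simp only [mul_smul]
    exact hb.const_smul m
  have hX2 := hk2 _ _ (tendsto_const_nhds (x := X)) hXp
  obtain ⟨N, N2, hNo, hrN, hNo2, hrN2, hNw⟩ := mem_nhds_prod_iff'.1 (hG.w_nhds p)
  obtain ⟨M, M2, hMo, haM, hMo2, haM2, hMw⟩ := mem_nhds_prod_iff'.1 (hG.w_nhds (m • c))
  have e1 := hk2.unif (hNo.mem_nhds hrN) (hMo.mem_nhds haM)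
  have e2 := hX2.eventually (hMo2.mem_nhds haM2)
  have e3 := (hX2.prodMk_nhds hb2).eventually (eventually_mem_nhds_iff.2 (hG.K0_int _ hm))
  obtain ⟨j, h1, h2, h3⟩ := (e1.and (e2.and e3)).exists
  set q := m * k j with hq
  have tx : Tendsto (fun i => q • x i) U (𝓝 (q • X)) := hx.const_smul q
  have ty : Tendsto (fun i => q • y i) U (𝓝 (q • p)) := hy.const_smul q
  have f1 := (tx.prodMk_nhds ty).eventually h3
  have f2 := tx.eventually (hMo2.mem_nhds h2)
  have f3 := hy.eventually (hNo2.mem_nhds hrN2)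
  have f4 := Lt.of_cross hG (g := fun _ => q⁻¹) (h := g) (x := x) (y := y) (U := U) (r := r)
    (a := q • p) (by simpa using hc.smul q) (by simpa using ty) hx'
  obtain ⟨i, i1, i2, i3, i4⟩ := (f1.and (f2.and (f3.and f4))).exists
  refine hs.gap i q⁻¹ (by simpa [Pr] using i1) (fun z => ?_) i4
  rcases h1 z with h | h
  · right
    have := @hNw (z, y i) ⟨h, i3⟩
    simpa using this
  · left
    have := @hMw (q • z, q • x i) ⟨h, i2⟩
    simpa using this

/-- The key step: the attracting point of a gap sequence is the image of the repelling point. -/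
lemma gap_key (h3 : HasThreePts T) (h3d : ThreeDisc fun (g : G) (x : T) => g • x)
    (hG : Good G v w K0) {U : Ultrafilter I} {g : I → G} {x y : I → T}
    (hs : GapSeq v w g x y) (hg : Esc U g) :
    ∃ r p : T, Cross U g r p ∧ ∀ᶠ i in (U : Filter I), g i • r = p := by
  obtain ⟨r, p, hc⟩ := exists_cross h3 h3d U _ hg
  refine ⟨r, p, hc, ?_⟩
  obtain ⟨X, hX⟩ := ult_lim U x
  obtain ⟨Y, hY⟩ := ult_lim U y
  obtain ⟨X', hX'⟩ := ult_lim U (fun i => (g i)⁻¹ • x i)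
  obtain ⟨Y', hY'⟩ := ult_lim U (fun i => (g i)⁻¹ • y i)
  have hv : (X, Y) ∉ v := lim_not_v hG hX hY (Eventually.of_forall hs.one)
  have hv' : (X', Y') ∉ v := lim_not_v hG hX' hY' (Eventually.of_forall hs.pr)
  have hne := hG.v_ne hv
  have hne' := hG.v_ne hv'
  rcases pos hc hX hY hX' hY' hne hne' with ⟨rfl, rfl⟩ | ⟨rfl, rfl⟩
  swap
  · exact (not_bad_right hG hc hX' (fun h => hv' (hG.v_symm _ _ h)) (y := y)
      (Eventually.of_forall hs.lt)).elim
  -- now `p = lim y`, `r = lim g⁻¹ x`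
  have ncp : ∀ {k : I → G} {c : T}, Cross U k p c → Tendsto (fun i => k i • p) U (𝓝 c) :=
    fun hk => nonconical hG hs hc hX hne hY hX' hk
  have ncr : ∀ {k : I → G} {c : T}, Cross U k r c → Tendsto (fun i => k i • r) U (𝓝 c) :=
    fun hk => nonconical hG (hs.swap hG) hc.inv hY' hne'.symm hX' (by simpa using hY) hk
  have t1 : Tendsto (fun i => (g i)⁻¹ • p) U (𝓝 r) := ncp hc.inv
  have t2 : Tendsto (fun i => g i • r) U (𝓝 p) := ncr hc
  by_contra hcon
  have hcon' := Ultrafilter.eventually_not.2 hcon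
  have : ∀ i, ∃ h : G, g i • r ≠ p → (h • p, h • (g i • r)) ∈ K0 := by
    intro i
    by_cases hi : g i • r = p
    · exact ⟨1, fun h => (h hi).elim⟩
    · obtain ⟨h, hh⟩ := hG.K0_cov p (g i • r) (Ne.symm hi)
      exact ⟨h, fun _ => hh⟩
  choose h hh using this
  obtain ⟨b, hb⟩ := ult_lim U (fun i => h i • p)
  obtain ⟨c, hcl⟩ := ult_lim U (fun i => h i • (g i • r))
  have hbc : (b, c) ∈ K0 := by
    refine hG.K0_closed.mem_of_tendsto (hb.prodMk_nhds hcl) ?_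
    filter_upwards [hcon'] with i hi using hh i hi
  have hbc' : b ≠ c := hG.K0_ne hbc
  have hEsc : Esc U h := by
    by_contra hne
    obtain ⟨m, hm⟩ := Esc.of_not hne
    have b1 : Tendsto (fun i => h i • p) U (𝓝 (m • p)) :=
      tendsto_const_nhds.congr' (by filter_upwards [hm] with i hi; rw [hi])
    have b2 : Tendsto (fun i => h i • (g i • r)) U (𝓝 (m • p)) :=
      (t2.const_smul m).congr' (by filter_upwards [hm] with i hi; rw [hi])
    exact hbc' ((tendsto_nhds_unique hb b1).trans (tendsto_nhds_unique hcl b2).symm)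
  obtain ⟨rh, ah, hch⟩ := exists_cross h3 h3d U _ hEsc
  have hrh : rh = p := by
    by_contra hne
    exact hbc' ((tendsto_nhds_unique hb (hch _ _ tendsto_const_nhds (Ne.symm hne))).trans
      (tendsto_nhds_unique hcl (hch _ _ t2 (Ne.symm hne))).symm)
  subst hrh
  have hah : ah = b := tendsto_nhds_unique (ncp hch) hb
  subst hah
  have hhx := hch _ _ hX hne
  -- the family f = h g
  have fr : Tendsto (fun i => (h i * g i) • r) U (𝓝 c) := by simpa only [mul_smul] using hcl
  have fp : Tendsto (fun i => (h i * g i) • ((g i)⁻¹ • rh)) U (𝓝 ah) := by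
    simpa only [mul_smul, smul_inv_smul] using hb
  have hEscf : Esc U (fun i => h i * g i) := by
    by_contra hne
    obtain ⟨m, hm⟩ := Esc.of_not hne
    have b1 : Tendsto (fun i => (h i * g i) • r) U (𝓝 (m • r)) :=
      tendsto_const_nhds.congr' (by filter_upwards [hm] with i hi; rw [hi])
    have b2 : Tendsto (fun i => (h i * g i) • ((g i)⁻¹ • rh)) U (𝓝 (m • r)) :=
      (t1.const_smul m).congr' (by filter_upwards [hm] with i hi; rw [hi])
    exact hbc' ((tendsto_nhds_unique fp b2).trans (tendsto_nhds_unique fr b1).symm)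
  obtain ⟨rf, af, hcf⟩ := exists_cross h3 h3d U _ hEscf
  have hrf : rf = r := by
    by_contra hne
    exact hbc' ((tendsto_nhds_unique fp (hcf _ _ t1 (Ne.symm hne))).trans
      (tendsto_nhds_unique fr (hcf _ _ tendsto_const_nhds (Ne.symm hne))).symm)
  subst hrf
  have haf : af = c := tendsto_nhds_unique (ncr hcf) fr
  subst haf
  have hhy : Tendsto (fun i => h i • y i) U (𝓝 af) := by
    have := hcf _ _ hY' hne'.symm
    simpa only [mul_smul, smul_inv_smul] using this
  have f1 := (hhx.prodMk_nhds hhy).eventually (hG.K0_int _ hbc)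
  have f2 := Lt.of_cross hG (g := fun _ => (1 : G)) (h := fun i => (h i)⁻¹) (x := x) (y := y)
    (by simpa using hch.inv) (by simpa using hY) (by simpa using hhx)
  have f3 := Lt.of_cross hG (g := fun i => (h i)⁻¹) (h := g) (x := x) (y := y)
    (by simpa using hcf) (by simpa using hhy) hX'
  obtain ⟨i, i1, i2, i3⟩ := (f1.and (f2.and f3)).exists
  exact hs.gap i (h i)⁻¹ (by simpa [Pr] using i1) i2 i3

/-- In a line not contained in one coset of `H` there is a gap between two cosets. -/
lemma exists_gap (h3 : HasThreePts T) (h3d : ThreeDisc fun (g : G) (x : T) => g • x)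
    (hG : Good G v w K0) (H : Subgroup G) {x y : T} {g k : G} (hg : Pr v x y g) (hk : Pr v x y k)
    (hlt : Lt w x y g k) (hH : g⁻¹ * k ∉ H) :
    ∃ g' k', Pr v x y g' ∧ Pr v x y k' ∧ Lt w x y g' k' ∧ g'⁻¹ * k' ∉ H ∧
      ∀ h, Pr v x y h → Lt w x y g' h → Lt w x y h k' → False := by
  have hxy := hg.ne hG
  induction hn : {h : G | Pr v x y h ∧ Lt w x y g h ∧ Lt w x y h k}.ncard using
    Nat.strong_induction_on generalizing g k with
  | _ n ih =>
    by_cases hgap : ∀ h, Pr v x y h → Lt w x y g h → Lt w x y h k → False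
    · exact ⟨g, k, hg, hk, hlt, hH, hgap⟩
    push Not at hgap
    obtain ⟨h, hh, h1, h2, -⟩ := hgap
    have hfin := interval_finite h3 h3d hG hxy g k
    by_cases hgh : g⁻¹ * h ∈ H
    · have hhk : h⁻¹ * k ∉ H := by
        intro h'
        apply hH
        have := H.mul_mem hgh h'
        simpa [mul_assoc] using this
      refine ih _ ?_ hh hk h2 hhk rfl
      rw [← hn]
      refine Set.ncard_lt_ncard ⟨?_, ?_⟩ hfin
      · rintro z ⟨a, b, c⟩
        exact ⟨a, Lt.trans hG hh h1 b, c⟩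
      · intro hsub
        exact Lt.irrefl hG (hsub (show h ∈ _ from ⟨hh, h1, h2⟩)).2.1
    · refine ih _ ?_ hg hh h1 hgh rfl
      rw [← hn]
      refine Set.ncard_lt_ncard ⟨?_, ?_⟩ hfin
      · rintro z ⟨a, b, c⟩
        exact ⟨a, b, Lt.trans hG hh c h2⟩
      · intro hsub
        exact Lt.irrefl hG (hsub (show h ∈ _ from ⟨hh, h1, h2⟩)).2.2

/-- Claim A -/
lemma claimA (h3 : HasThreePts T) (h3d : ThreeDisc fun (g : G) (x : T) => g • x)
    (hG : Good G v w K0) (N : Set G)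
    (hN : ∀ p : T, (MulAction.stabilizer G p : Set G).Infinite →
      (∀ q : T, (∀ g ∈ MulAction.stabilizer G p, g • q = q) → q = p) →
      (MulAction.stabilizer G p : Set G) ⊆ N) :
    ∃ S : Finset G, ∀ (x y : T) (g k : G), Pr v x y g → Pr v x y k →
      g⁻¹ * k ∈ Subgroup.closure ((S : Set G) ∪ N) := by
  classical
  by_contra! hcon
  have hF := total h3 h3d hG
  set F := hF.toFinset with hFdef
  have step : ∀ S : Finset G, ∃ (x y : T) (g : G), (x, y) ∉ v ∧ Pr v x y g ∧ Lt w x y 1 g ∧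
      g ∉ Subgroup.closure ((S : Set G) ∪ N) ∧
      ∀ h, Pr v x y h → Lt w x y 1 h → Lt w x y h g → False := by
    intro S
    obtain ⟨x, y, g, k, hg, hk, hgk⟩ := hcon (S ∪ F)
    set H := Subgroup.closure (((S ∪ F : Finset G) : Set G) ∪ N) with hH
    have hle : Subgroup.closure ((S : Set G) ∪ N) ≤ H := by
      apply Subgroup.closure_mono
      apply Set.union_subset_union_left
      simp
    obtain ⟨g', k', p1, p2, p3, p4, p5⟩ : ∃ g' k', Pr v x y g' ∧ Pr v x y k' ∧ Lt w x y g' k' ∧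
        g'⁻¹ * k' ∉ H ∧ ∀ h, Pr v x y h → Lt w x y g' h → Lt w x y h k' → False := by
      by_cases c1 : Lt w x y g k
      · exact exists_gap h3 h3d hG H hg hk c1 hgk
      by_cases c2 : Lt w x y k g
      · refine exists_gap h3 h3d hG H hk hg c2 ?_
        intro h
        apply hgk
        have := H.inv_mem h
        simpa using this
      exfalso
      apply hgk
      apply Subgroup.subset_closure
      left
      rw [Finset.coe_union]
      right
      rw [hFdef, Set.Finite.coe_toFinset]
      refine ⟨g⁻¹ • x, g⁻¹ • y, ?_, (Pr.smul_iff _).2 hk, ?_, ?_⟩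
      · simpa using (Pr.smul_iff (v := v) g⁻¹).2 hg
      · intro h
        apply c1
        rw [← Lt.smul_iff g⁻¹]
        simpa using h
      · intro h
        apply c2
        rw [← Lt.smul_iff g⁻¹]
        simpa using h
    refine ⟨g'⁻¹ • x, g'⁻¹ • y, g'⁻¹ * k', p1, (Pr.smul_iff _).2 p2, ?_, fun h => p4 (hle h), ?_⟩
    · simpa using (Lt.smul_iff (w := w) g'⁻¹).2 p3
    · intro h h1 h2 h3
      have a1 := (Pr.smul_iff (v := v) g').2 h1
      have a2 := (Lt.smul_iff (w := w) g').2 h2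
      have a3 := (Lt.smul_iff (w := w) g').2 h3
      simp only [smul_inv_smul, mul_one, mul_inv_cancel_left] at a1 a2 a3
      exact p5 _ a1 a2 a3
  choose x y g h1 h2 h3' h4 h5 using step
  have hs : GapSeq v w g x y := ⟨h1, h2, h3', h5⟩
  let U : Ultrafilter (Finset G) := Ultrafilter.of atTop
  have hU : (U : Filter (Finset G)) ≤ atTop := Ultrafilter.of_le _
  have hmem : ∀ c : G, ∀ᶠ S in (U : Filter (Finset G)), c ∈ S := by
    intro c
    refine hU ?_
    filter_upwards [eventually_ge_atTop {c}] with S hS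
    exact hS (by simp)
  have hEsc : Esc U g := by
    intro c
    filter_upwards [hmem c] with S hS
    rintro rfl
    exact h4 S (Subgroup.subset_closure (Or.inl hS))
  obtain ⟨r, p, hc, hrp⟩ := gap_key h3 h3d hG hs hEsc
  obtain ⟨S0, hS0⟩ := hrp.exists
  have hr : (g S0)⁻¹ • p = r := by rw [← hS0, inv_smul_smul]
  have hst : ∀ᶠ S in (U : Filter (Finset G)), g S * (g S0)⁻¹ ∈ MulAction.stabilizer G p := by
    filter_upwards [hrp] with S hS
    rw [MulAction.mem_stabilizer_iff, mul_smul, hr, hS]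
  have hsub := hN p ?_ ?_
  · obtain ⟨S, a, b⟩ := (hst.and (hmem (g S0))).exists
    apply h4 S
    have a1 : g S * (g S0)⁻¹ ∈ Subgroup.closure ((S : Set G) ∪ N) :=
      Subgroup.subset_closure (Or.inr (hsub a))
    have a2 : g S0 ∈ Subgroup.closure ((S : Set G) ∪ N) := Subgroup.subset_closure (Or.inl b)
    simpa using Subgroup.mul_mem _ a1 a2
  · intro hfin
    refine hEsc.not_finite (hfin.image (fun h => h * g S0)) ?_
    filter_upwards [hst] with S hS
    exact ⟨_, hS, by simp⟩
  · intro q hq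
    by_contra hne
    have hq' : (g S0)⁻¹ • q ≠ r := by
      rw [← hr]
      simpa using hne
    have t := hc _ _ tendsto_const_nhds hq'
    have tq : Tendsto (fun S => g S • ((g S0)⁻¹ • q)) U (𝓝 q) :=
      tendsto_const_nhds.congr' (by
        filter_upwards [hst] with S hS
        rw [← mul_smul, hq _ hS])
    exact hne (tendsto_nhds_unique tq t)

/-- Claim B -/
lemma claimB (hG : Good G v w K0) (hne : HasThreePts T) (H : Subgroup G)
    (hA : ∀ (x y : T) (g k : G), Pr v x y g → Pr v x y k → g⁻¹ * k ∈ H) : H = ⊤ := by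
  have tr : ∀ {a b c : G}, a⁻¹ * b ∈ H → b⁻¹ * c ∈ H → a⁻¹ * c ∈ H := by
    intro a b c h1 h2
    have := H.mul_mem h1 h2
    simpa [mul_assoc] using this
  have ex : ∀ x y : T, x ≠ y → ∃ k : G, Pr v x y k ∧ ∀ z, Pr v x z k ∨ Pr v z y k := by
    intro x y hxy
    obtain ⟨g, hg⟩ := hG.K0_cov x y hxy
    refine ⟨g⁻¹, ?_, fun z => ?_⟩
    · have := mem_of_mem_nhds (hG.K0_int _ hg)
      simpa [Pr] using this
    · simpa [Pr] using hG.K0_tri _ (g • z) _ hg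
  have share : ∀ (x y z : T) (g k : G), Pr v x y g → Pr v x z k → g⁻¹ * k ∈ H := by
    intro x y z g k hg hk
    obtain ⟨l, hl, hl'⟩ := ex x z (hk.ne hG)
    obtain ⟨m, hm, hm'⟩ := ex x y (hg.ne hG)
    rcases hl' y with c | c
    · exact tr (hA _ _ _ _ hg c) (hA _ _ _ _ hl hk)
    rcases hm' z with d | d
    · exact tr (hA _ _ _ _ hg hm) (hA _ _ _ _ d hk)
    exact tr (hA _ _ _ _ hg hm) (tr (hA _ _ _ _ (d.symm hG) c) (hA _ _ _ _ hl hk))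
  obtain ⟨x, y, -, hxy, -⟩ := hne
  obtain ⟨g0, h0, -⟩ := ex x y hxy
  have all : ∀ (x' y' : T) (k : G), Pr v x' y' k → g0⁻¹ * k ∈ H := by
    intro x' y' k hk
    by_cases h : x = y'
    · subst h
      exact share _ _ _ _ _ h0 (hk.symm hG)
    · obtain ⟨l, hl, -⟩ := ex x y' h
      exact tr (share _ _ _ _ _ h0 hl) (share _ _ _ _ _ (hl.symm hG) (hk.symm hG))
  rw [eq_top_iff]
  intro g _
  have h1 := all _ _ _ ((Pr.smul_iff (v := v) g0).2 ((Pr.smul_iff (v := v) g).2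
    ((Pr.smul_iff (v := v) g0⁻¹).2 h0)))
  simpa using h1

end cross

lemma exists_good {G : Type*} [Group G] {T : Type*} [UniformSpace T] [CompactSpace T] [T2Space T]
    [MulAction G T] (h3 : HasThreePts T) (h2c : TwoCocompact fun (g : G) (x : T) => g • x) :
    ∃ v w K0 : Set (T × T), Good G v w K0 := by
  obtain ⟨K0, hK, hKd, hcov⟩ := h2c
  obtain ⟨z1, z2, z3, d12, d13, d23⟩ := h3
  have nh : ∀ s : Set (T × T), IsClosed s → (∀ p, (p, p) ∉ s) → sᶜ ∈ uniformity T := by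
    intro s hs hp
    rw [← nhdsSet_diagonal_eq_uniformity]
    rw [hs.isOpen_compl.mem_nhdsSet]
    rintro ⟨a, b⟩ hab
    simp only [Set.mem_diagonal_iff] at hab
    subst hab
    exact hp a
  have hK0 := nh K0 hK.isClosed (fun p hp => hKd hp rfl)
  obtain ⟨v1, hv1, hv1o, hv1s, hv1c⟩ := comp_open_symm_mem_uniformity_sets hK0
  obtain ⟨v0, hv0, hv0c, hv0v⟩ := mem_uniformity_isClosed hv1
  obtain ⟨v, hv, hvo, hvs, hvc⟩ := comp_open_symm_mem_uniformity_sets hv0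
  have hvv0 : v ⊆ v0 := (subset_comp_self_of_mem_uniformity hv).trans hvc
  have hv10 : v1 ⊆ K0ᶜ := (subset_comp_self_of_mem_uniformity hv1).trans hv1c
  have hz : v ∩ ({(z1, z2), (z1, z3), (z2, z3)} : Set (T × T))ᶜ ∈ uniformity T := by
    refine Filter.inter_mem hv (nh _ (Set.Finite.isClosed (by simp)) ?_)
    intro p hp
    simp only [Set.mem_insert_iff, Set.mem_singleton_iff, Prod.mk.injEq] at hp
    grind
  obtain ⟨w1, hw1, hw1o, hw1s, hw1c⟩ := comp_open_symm_mem_uniformity_sets hz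
  obtain ⟨w0, hw0, hw0c, hw0w⟩ := mem_uniformity_isClosed hw1
  have hw0s : (Prod.swap ⁻¹' w0 : Set (T × T)) ∈ uniformity T := symm_le_uniformity hw0
  have cmp : ∀ a b c, (a, b) ∈ w1 → (b, c) ∈ w1 →
      (a, c) ∈ v ∩ ({(z1, z2), (z1, z3), (z2, z3)} : Set (T × T))ᶜ :=
    fun a b c h1 h2 => hw1c ⟨b, h1, h2⟩
  have hw1v : w1 ⊆ v :=
    ((subset_comp_self_of_mem_uniformity hw1).trans hw1c).trans Set.inter_subset_left
  refine ⟨v, w0 ∩ Prod.swap ⁻¹' w0, K0, ?_⟩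
  have tri : ∀ a b c, (a, c) ∈ (({(z1, z2), (z1, z3), (z2, z3)} : Set (T × T))) →
      ¬ ((a, b) ∈ w0 ∩ Prod.swap ⁻¹' w0 ∧ (c, b) ∈ w0 ∩ Prod.swap ⁻¹' w0) := by
    rintro a b c h ⟨⟨h1, h1'⟩, ⟨h2, h2'⟩⟩
    exact (cmp a b c (hw0w h1) (hw0w h2')).2 h
  exact
  { v_open := hvo
    v_symm := fun a b h => hvs.symm a b h
    v_refl := fun a => refl_mem_uniformity hv
    K0_closed := hK.isClosed
    K0_cov := fun x y h => hcov (x, y) h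
    K0_int := by
      intro p hp
      refine Filter.mem_of_superset (hv0c.isOpen_compl.mem_nhds ?_) (Set.compl_subset_compl.2 hvv0)
      exact fun h => hv10 (hv0v h) hp
    K0_tri := by
      intro a b c h
      by_contra! hc
      exact hv10 (hv0v (hvc ⟨b, hc.1, hc.2⟩)) h
    w_nhds := fun p => by
      exact nhds_le_uniformity p (Filter.inter_mem hw0 hw0s)
    w_symm := fun a b h => ⟨h.2, h.1⟩
    w_v := fun a b c h1 h2 => (cmp a b c (hw0w h1.1) (hw0w h2.1)).1
    w_cl := by
      intro p hp
      refine Filter.mem_of_superset (hw0c.isOpen_compl.mem_nhds ?_)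
        (Set.compl_subset_compl.2 Set.inter_subset_left)
      exact fun h => hp (hw1v (hw0w h))
    w_three := ⟨z1, z2, z3, fun c => ⟨tri _ _ _ (by simp), tri _ _ _ (by simp),
      tri _ _ _ (by simp)⟩⟩ }

end aux
end RHG

namespace RHG

/-- Let `G` be a group acting 3-discontinuously and 2-cocompactly on a compactum `T`.
Then `G` is finitely generated with respect to the stabilizers of the parabolic points:
there is a finite subset `S ⊆ G` such that `G` is generated by `S` together with the
stabilizers of the parabolic points. -/
theorem finitely_generated_rel_parabolics {G : Type*} [Group G]
    {T : Type*} [TopologicalSpace T] [CompactSpace T] [T2Space T] (h3 : HasThreePts T)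
    (ρ : G → T ≃ₜ T) (hρ : IsTopAction G T ρ)
    (h3d : ThreeDisc fun (g : G) (x : T) => ρ g x)
    (h2c : TwoCocompact fun (g : G) (x : T) => ρ g x) :
    ∃ S : Finset G,
      Subgroup.closure ((S : Set G) ∪
        ⋃ p ∈ {p : T | IsParabolicPt ρ hρ p}, (actStab ρ hρ p : Set G)) = ⊤ := by
  classical
  letI : MulAction G T :=
    { smul := fun g x => ρ g x
      one_smul := fun x => by
        change ρ 1 x = x
        rw [hρ.map_one]
        rfl
      mul_smul := fun g h x => by
        change ρ (g * h) x = ρ g (ρ h x)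
        rw [hρ.map_mul]
        rfl }
  have hsm : ∀ (g : G) (x : T), g • x = ρ g x := fun _ _ => rfl
  haveI : ContinuousConstSMul G T := ⟨fun g => (ρ g).continuous⟩
  obtain ⟨v, w, K0, hG⟩ : ∃ v w K0 : Set (T × T), Good G v w K0 := by
    letI : UniformSpace T := uniformSpaceOfCompactR1
    exact exists_good h3 h2c
  obtain ⟨S, hS⟩ := claimA h3 h3d hG
    (⋃ p ∈ {p : T | IsParabolicPt ρ hρ p}, (actStab ρ hρ p : Set G)) (by
      intro p h1 h2
      exact Set.subset_biUnion_of_mem (u := fun p => (actStab ρ hρ p : Set G))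
        (show p ∈ {p : T | IsParabolicPt ρ hρ p} from ⟨h1, h2⟩))
  exact ⟨S, claimB hG h3 _ hS⟩

end RHG
end

section
/- Let G be a group admitting a 3-discontinuous and 2-cocompact action on a compactum T. Then there is a constant C such that for every pair of distinct parabolic points p and q of the action one has |Stab_G p ∩ Stab_G q| ≤ C. -/
namespace RHG

open Filter Topology

set_option linter.unusedSectionVars false

section aux

variable {G T : Type*} [Group G] [TopologicalSpace T] [CompactSpace T] [T2Space T]
  [MulAction G T] [ContinuousConstSMul G T]

/-- limit relation along an ultrafilter -/
def LimRel {ι : Type*} (u : Ultrafilter ι) (g : ι → G) (a b : T) : Prop :=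
  ∀ U ∈ 𝓝 a, ∀ V ∈ 𝓝 b, ∀ᶠ i in (u : Filter ι), ∃ c ∈ U, g i • c ∈ V

lemma limRel_of_tendsto {ι : Type*} (u : Ultrafilter ι) (g : ι → G) (a b : T) (c : ι → T)
    (h1 : Tendsto c u (𝓝 a)) (h2 : Tendsto (fun i => g i • c i) u (𝓝 b)) : LimRel u g a b := by
  intro U hU V hV
  filter_upwards [h1 hU, h2 hV] with i h h'
  exact ⟨c i, h, h'⟩

lemma exists_lim {ι : Type*} (u : Ultrafilter ι) (c : ι → T) : ∃ a, Tendsto c u (𝓝 a) := by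
  obtain ⟨a, -, ha⟩ := isCompact_univ.ultrafilter_le_nhds (u.map c) (by simp)
  exact ⟨a, ha⟩

lemma sep3 {a b c : T} (h : a ≠ b) (h' : a ≠ c) (h'' : b ≠ c) :
    ∃ A ∈ 𝓝 a, ∃ B ∈ 𝓝 b, ∃ C ∈ 𝓝 c, IsCompact (A ×ˢ (B ×ˢ C)) ∧
      A ×ˢ (B ×ˢ C) ⊆ distinct3 := by
  have hopen : IsOpen (distinct3 : Set (T × T × T)) := by
    unfold distinct3
    refine (isOpen_ne_fun ?_ ?_).inter ((isOpen_ne_fun ?_ ?_).inter (isOpen_ne_fun ?_ ?_)) <;>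
      fun_prop
  have hn : (distinct3 : Set (T × T × T)) ∈ 𝓝 (a, b, c) := hopen.mem_nhds ⟨h, h', h''⟩
  rw [nhds_prod_eq, nhds_prod_eq] at hn
  obtain ⟨A, hA, W, hW, hs⟩ := mem_prod_iff.1 hn
  obtain ⟨B, hB, C, hC, hs'⟩ := mem_prod_iff.1 hW
  obtain ⟨A', hA', hAc, hAA⟩ := exists_mem_nhds_isClosed_subset hA
  obtain ⟨B', hB', hBc, hBB⟩ := exists_mem_nhds_isClosed_subset hB
  obtain ⟨C', hC', hCc, hCC⟩ := exists_mem_nhds_isClosed_subset hC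
  refine ⟨A', hA', B', hB', C', hC', (hAc.prod (hBc.prod hCc)).isCompact, ?_⟩
  exact (Set.prod_mono hAA ((Set.prod_mono hBB hCC).trans hs')).trans hs

lemma finite_trans (hd : ThreeDisc fun (g : G) (x : T) => g • x) {K L : Set (T × T × T)}
    (hK : IsCompact K) (hK' : K ⊆ distinct3) (hL : IsCompact L) (hL' : L ⊆ distinct3) :
    {g : G | ∃ a b c : T, (a, b, c) ∈ K ∧ (g • a, g • b, g • c) ∈ L}.Finite := by
  refine (hd (K ∪ L) (hK.union hL) (Set.union_subset hK' hL')).subset ?_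
  rintro g ⟨a, b, c, h, h'⟩
  exact ⟨_, ⟨(a, b, c), Or.inl h, rfl⟩, Or.inr h'⟩

lemma no_match (hd : ThreeDisc fun (g : G) (x : T) => g • x)
    {ι : Type*} (u : Ultrafilter ι) (g : ι → G) (hg : Tendsto g u cofinite)
    {a b c a' b' c' : T} (h1 : LimRel u g a a') (h2 : LimRel u g b b') (h3 : LimRel u g c c')
    (ab : a ≠ b) (ac : a ≠ c) (bc : b ≠ c) (ab' : a' ≠ b') (ac' : a' ≠ c') (bc' : b' ≠ c') :
    False := by
  obtain ⟨A, hA, B, hB, C, hC, hK, hK'⟩ := sep3 ab ac bc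
  obtain ⟨A', hA', B', hB', C', hC', hL, hL'⟩ := sep3 ab' ac' bc'
  have hf := finite_trans hd hK hK' hL hL'
  have hev := hg hf.compl_mem_cofinite
  have := (((h1 A hA A' hA').and (h2 B hB B' hB')).and (h3 C hC C' hC')).and hev
  obtain ⟨i, ⟨⟨⟨p, hp, hp'⟩, ⟨q, hq, hq'⟩⟩, ⟨r, hr, hr'⟩⟩, hi⟩ := this.exists
  exact hi ⟨p, q, r, ⟨hp, hq, hr⟩, ⟨hp', hq', hr'⟩⟩

lemma dyn_aux {ι : Type*} (u : Ultrafilter ι) (g : ι → G) {x y : T}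
    (hR : ∀ c d, LimRel u g c d → c = x ∨ d = y) (U : Set T) (hU : U ∈ 𝓝 x)
    (V : Set T) (hV : V ∈ 𝓝 y) : ∀ᶠ i in (u : Filter ι), ∀ c, c ∉ U → g i • c ∈ V := by
  by_contra hcon
  rw [← Ultrafilter.eventually_not] at hcon
  have : ∀ i, ∃ c, (¬ ∀ c, c ∉ U → g i • c ∈ V) → c ∉ U ∧ g i • c ∉ V := by
    intro i
    by_cases h : ∀ c, c ∉ U → g i • c ∈ V
    · exact ⟨x, fun h' => absurd h h'⟩
    · have h2 := h
      push Not at h2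
      obtain ⟨c, hc⟩ := h2
      exact ⟨c, fun _ => hc⟩
  choose c hc using this
  obtain ⟨a, ha⟩ := exists_lim u c
  obtain ⟨b, hb⟩ := exists_lim u (fun i => g i • c i)
  rcases hR a b (limRel_of_tendsto u g a b c ha hb) with rfl | rfl
  · obtain ⟨i, h, h'⟩ := (hcon.and (ha hU)).exists
    exact (hc i h).1 h'
  · obtain ⟨i, h, h'⟩ := (hcon.and (hb hV)).exists
    exact (hc i h).2 h'

lemma dyn_half (hd : ThreeDisc fun (g : G) (x : T) => g • x)
    {ι : Type*} (u : Ultrafilter ι) (g : ι → G) (hg : Tendsto g u cofinite)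
    {x y e : T} (hxy : x ≠ y) (hx : LimRel u g x x) (hy : LimRel u g y y)
    (hex : e ≠ x) (hey : e ≠ y) (he : LimRel u g x e) :
    ∀ c d, LimRel u g c d → c = x ∨ d = y := by
  have key : ∀ c d, c ≠ x → c ≠ y → LimRel u g c d → d = y := by
    intro c d hcx hcy hcd
    by_contra hdy
    by_cases hdx : d = x
    · subst hdx
      exact no_match hd u g hg he hcd hy hcx.symm hxy hcy hex hey hdy
    · exact no_match hd u g hg hcd hx hy hcx hcy hxy hdx hdy hxy
  intro c d hcd
  by_contra hcon
  push Not at hcon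
  obtain ⟨hcx, hdy⟩ := hcon
  by_cases hcy : c = y
  · subst hcy
    obtain ⟨b, hb⟩ := exists_lim u (fun i => g i • e)
    have heb := limRel_of_tendsto u g e b (fun _ => e) tendsto_const_nhds hb
    have := key e b hex hey heb
    subst this
    by_cases hdx : d = x
    · subst hdx
      exact no_match hd u g hg hcd heb he hey.symm hxy.symm hex hxy hex.symm hey.symm
    · exact no_match hd u g hg hcd heb hx hey.symm hxy.symm hex hdy hdx hxy.symm
  · exact hdy (key c d hcx hcy hcd)

lemma dyn (h3 : HasThreePts T) (hd : ThreeDisc fun (g : G) (x : T) => g • x)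
    {ι : Type*} (u : Ultrafilter ι) (g : ι → G) (hg : Tendsto g u cofinite)
    {x y : T} (hxy : x ≠ y) (P Q : ι → T) (hP : Tendsto P u (𝓝 x)) (hQ : Tendsto Q u (𝓝 y))
    (hfP : ∀ᶠ i in (u : Filter ι), g i • P i = P i)
    (hfQ : ∀ᶠ i in (u : Filter ι), g i • Q i = Q i) :
    (∀ U ∈ 𝓝 x, ∀ V ∈ 𝓝 y, ∀ᶠ i in (u : Filter ι), ∀ c, c ∉ U → g i • c ∈ V) ∨
    (∀ U ∈ 𝓝 y, ∀ V ∈ 𝓝 x, ∀ᶠ i in (u : Filter ι), ∀ c, c ∉ U → g i • c ∈ V) := by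
  have hx : LimRel u g x x := limRel_of_tendsto u g x x P hP
    (hP.congr' (hfP.mono fun i h => h.symm))
  have hy : LimRel u g y y := limRel_of_tendsto u g y y Q hQ
    (hQ.congr' (hfQ.mono fun i h => h.symm))
  obtain ⟨e, hex, hey⟩ : ∃ e : T, e ≠ x ∧ e ≠ y := by
    obtain ⟨a, b, c, h1, h2, h3⟩ := h3
    by_contra hcon
    push Not at hcon
    have key : ∀ t, t = x ∨ t = y := fun t => or_iff_not_imp_left.2 (hcon t)
    rcases key a with ha | ha <;> rcases key b with hb | hb <;> rcases key c with hc | hc <;>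
      first
      | exact h1 (ha.trans hb.symm)
      | exact h2 (ha.trans hc.symm)
      | exact h3 (hb.trans hc.symm)
  obtain ⟨f, hf⟩ := exists_lim u (fun i => (g i)⁻¹ • e)
  have hfe : LimRel u g f e := limRel_of_tendsto u g f e _ hf (by simp)
  by_cases hfx : f = x
  · subst hfx
    left
    exact fun U hU V hV => dyn_aux u g (dyn_half hd u g hg hxy hx hy hex hey hfe) U hU V hV
  by_cases hfy : f = y
  · subst hfy
    right
    exact fun U hU V hV => dyn_aux u g (dyn_half hd u g hg hxy.symm hy hx hey hex hfe) U hU V hV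
  exact (no_match hd u g hg hfe hx hy hfx hfy hxy hex hey hxy).elim

/-- disjoint neighbourhoods missing a third point -/
lemma sepz (h3 : HasThreePts T) {x y : T} (hxy : x ≠ y) :
    ∃ U V : Set T, ∃ z : T, IsOpen U ∧ IsOpen V ∧ x ∈ U ∧ y ∈ V ∧ Disjoint U V ∧
      z ∉ U ∧ z ∉ V := by
  obtain ⟨e, hex, hey⟩ : ∃ e : T, e ≠ x ∧ e ≠ y := by
    obtain ⟨a, b, c, h1, h2, h3⟩ := h3
    by_contra hcon
    push Not at hcon
    have key : ∀ t, t = x ∨ t = y := fun t => or_iff_not_imp_left.2 (hcon t)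
    rcases key a with ha | ha <;> rcases key b with hb | hb <;> rcases key c with hc | hc <;>
      first
      | exact h1 (ha.trans hb.symm)
      | exact h2 (ha.trans hc.symm)
      | exact h3 (hb.trans hc.symm)
  obtain ⟨U, V, hU, hV, hx, hy, hUV⟩ := t2_separation hxy
  refine ⟨U \ {e}, V \ {e}, e, hU.sdiff isClosed_singleton, hV.sdiff isClosed_singleton,
    ⟨hx, by simpa using hex.symm⟩, ⟨hy, by simpa using hey.symm⟩,
    hUV.mono Set.sdiff_subset Set.sdiff_subset, by simp, by simp⟩

lemma pow_mem_V {U V : Set T} (hUV : Disjoint U V) {z : T} (hzU : z ∉ U) {g : G}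
    (hg : ∀ c, c ∉ U → g • c ∈ V) (n : ℕ) : g ^ (n + 1) • z ∈ V := by
  induction n with
  | zero => simpa using hg z hzU
  | succ n ih =>
    rw [pow_succ', mul_smul]
    exact hg _ (fun h => Set.disjoint_left.1 hUV h ih)

lemma not_finOrder {U V : Set T} (hUV : Disjoint U V) {z : T} (hzU : z ∉ U) (hzV : z ∉ V) {g : G}
    (hg : ∀ c, c ∉ U → g • c ∈ V) : ¬ IsOfFinOrder g := by
  intro h
  obtain ⟨n, hn, h1⟩ := isOfFinOrder_iff_pow_eq_one.1 h
  obtain ⟨m, rfl⟩ := Nat.exists_eq_succ_of_ne_zero hn.ne'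
  have := pow_mem_V hUV hzU hg m
  rw [Nat.succ_eq_add_one] at h1
  rw [h1, one_smul] at this
  exact hzV this

lemma local_bound (h3 : HasThreePts T) (hd : ThreeDisc fun (g : G) (x : T) => g • x)
    {x y : T} (hxy : x ≠ y) : ∃ W ∈ 𝓝 (x, y), ∃ S : Set G, S.Finite ∧ ∀ pq ∈ W, ∀ g : G,
      g • pq.1 = pq.1 → g • pq.2 = pq.2 → IsOfFinOrder g → g ∈ S := by
  by_contra hcon
  push Not at hcon
  let bad : Set (G × T × T) :=
    {i | i.1 • i.2.1 = i.2.1 ∧ i.1 • i.2.2 = i.2.2 ∧ IsOfFinOrder i.1}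
  have hne : ((cofinite ×ˢ 𝓝 (x, y)) ⊓ 𝓟 bad : Filter (G × T × T)).NeBot := by
    rw [← frequently_mem_iff_neBot]
    intro hev
    obtain ⟨A, hA, W, hW, hs⟩ := mem_prod_iff.1 hev
    obtain ⟨pq, hpq, g, h1, h2, h4, h5⟩ := hcon W hW Aᶜ (mem_cofinite.1 hA)
    exact hs (show (g, pq) ∈ A ×ˢ W from ⟨by simpa using h5, hpq⟩) ⟨h1, h2, h4⟩
  let u := Ultrafilter.of ((cofinite ×ˢ 𝓝 (x, y)) ⊓ 𝓟 bad : Filter (G × T × T))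
  have hu : (u : Filter (G × T × T)) ≤ (cofinite ×ˢ 𝓝 (x, y)) ⊓ 𝓟 bad := Ultrafilter.of_le _
  have hb : ∀ᶠ i in (u : Filter (G × T × T)), i ∈ bad := hu (mem_inf_of_right (mem_principal_self _))
  have h1 : Tendsto (fun i : G × T × T => i.1) u cofinite :=
    tendsto_fst.mono_left (hu.trans inf_le_left)
  have h2 : Tendsto (fun i : G × T × T => i.2) u (𝓝 (x, y)) :=
    tendsto_snd.mono_left (hu.trans inf_le_left)
  have hdyn := dyn h3 hd u (fun i => i.1) h1 hxy (fun i => i.2.1) (fun i => i.2.2)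
    ((continuous_fst.tendsto _).comp h2) ((continuous_snd.tendsto _).comp h2)
    (hb.mono fun i h => h.1) (hb.mono fun i h => h.2.1)
  obtain ⟨U, V, z, hU, hV, hx, hy, hUV, hzU, hzV⟩ := sepz h3 hxy
  rcases hdyn with h | h
  · obtain ⟨i, hi, hi'⟩ := ((h U (hU.mem_nhds hx) V (hV.mem_nhds hy)).and hb).exists
    exact not_finOrder hUV hzU hzV hi hi'.2.2
  · obtain ⟨i, hi, hi'⟩ := ((h V (hV.mem_nhds hy) U (hU.mem_nhds hx)).and hb).exists
    exact not_finOrder hUV.symm hzV hzU hi hi'.2.2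

lemma compact_bound (h3 : HasThreePts T) (hd : ThreeDisc fun (g : G) (x : T) => g • x)
    {K : Set (T × T)} (hK : IsCompact K) (hK' : K ⊆ distinct2) :
    ∃ S : Set G, S.Finite ∧ ∀ pq ∈ K, ∀ g : G,
      g • pq.1 = pq.1 → g • pq.2 = pq.2 → IsOfFinOrder g → g ∈ S := by
  refine hK.induction_on (p := fun K => ∃ S : Set G, S.Finite ∧ ∀ pq ∈ K, ∀ g : G,
      g • pq.1 = pq.1 → g • pq.2 = pq.2 → IsOfFinOrder g → g ∈ S) ?_ ?_ ?_ ?_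
  · exact ⟨∅, Set.finite_empty, by simp⟩
  · rintro s t hst ⟨S, hS, h⟩
    exact ⟨S, hS, fun pq hpq => h pq (hst hpq)⟩
  · rintro s t ⟨S, hS, h⟩ ⟨S', hS', h'⟩
    refine ⟨S ∪ S', hS.union hS', ?_⟩
    rintro pq (hpq | hpq) g h1 h2 h3
    · exact Or.inl (h pq hpq g h1 h2 h3)
    · exact Or.inr (h' pq hpq g h1 h2 h3)
  · intro pq hpq
    obtain ⟨W, hW, h⟩ := local_bound h3 hd (hK' hpq)
    exact ⟨W, mem_nhdsWithin_of_mem_nhds hW, h⟩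

/-- loxodromic with attracting point `p`, repelling `q`: no element fixes `p` but not `q`. -/
lemma lox (h3 : HasThreePts T) (hd : ThreeDisc fun (g : G) (x : T) => g • x)
    {p q : T} {U V : Set T} {z : T} (hU : IsOpen U) (hV : IsOpen V) (hq : q ∈ U)
    (hp : p ∈ V) (hUV : Disjoint U V) (hzU : z ∉ U) (hzV : z ∉ V) {g : G}
    (hgp : g • p = p) (hgq : g • q = q) (hg : ∀ c, c ∉ U → g • c ∈ V)
    {h : G} (hhp : h • p = p) : h • q = q := by
  by_contra hhq
  have hpq : p ≠ q := fun e => Set.disjoint_left.1 hUV hq (e ▸ hp)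
  have hzp : z ≠ p := fun e => hzV (e ▸ hp)
  have hzq : z ≠ q := fun e => hzU (e ▸ hq)
  have hgpn : ∀ n : ℕ, g ^ n • p = p := fun n => by
    induction n with
    | zero => simp
    | succ n ih => rw [pow_succ, mul_smul, hgp, ih]
  have hgqn : ∀ n : ℕ, g ^ n • q = q := fun n => by
    induction n with
    | zero => simp
    | succ n ih => rw [pow_succ, mul_smul, hgq, ih]
  have hginf := not_finOrder hUV hzU hzV hg
  have hinj : Function.Injective fun n : ℕ => g ^ n := injective_pow_iff_not_isOfFinOrder.2 hginf
  -- dynamics of powers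
  have hdyn : ∀ U' ∈ 𝓝 q, ∀ V' ∈ 𝓝 p, ∀ᶠ n : ℕ in atTop, ∀ c, c ∉ U' → g ^ n • c ∈ V' := by
    intro U' hU' V' hV'
    rw [Filter.eventually_iff, mem_iff_ultrafilter]
    intro u hu
    have ht : Tendsto (fun n : ℕ => g ^ n) u cofinite := by
      have := hinj.tendsto_cofinite
      rw [Nat.cofinite_eq_atTop] at this
      exact this.mono_left hu
    rcases dyn h3 hd u (fun n : ℕ => g ^ n) ht hpq (fun _ => p) (fun _ => q) tendsto_const_nhds
      tendsto_const_nhds (Eventually.of_forall hgpn) (Eventually.of_forall hgqn) with h1 | h1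
    · exfalso
      obtain ⟨n, hn, hn'⟩ := ((h1 V (hV.mem_nhds hp) U (hU.mem_nhds hq)).and
        (hu (eventually_ge_atTop 1))).exists
      obtain ⟨m, rfl⟩ := Nat.exists_eq_add_of_le' hn'
      exact Set.disjoint_left.1 hUV (hn z hzV) (pow_mem_V hUV hzU hg m)
    · exact h1 U' hU' V' hV'
  have hfwd : ∀ c, c ≠ q → Tendsto (fun n : ℕ => g ^ n • c) atTop (𝓝 p) := by
    intro c hc V' hV'
    rw [mem_map]
    filter_upwards [hdyn {c}ᶜ (isOpen_compl_singleton.mem_nhds hc.symm) V' hV'] with n hn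
    exact hn c (by simp)
  have hbwd : ∀ c, c ≠ p → Tendsto (fun n : ℕ => (g ^ n)⁻¹ • c) atTop (𝓝 q) := by
    intro c hc U' hU'
    rw [mem_map]
    filter_upwards [hdyn U' hU' {c}ᶜ (isOpen_compl_singleton.mem_nhds hc.symm)] with n hn
    by_contra hcon
    exact hn _ hcon (by simp)
  have hhqp : h • q ≠ p := fun e => hpq (by
    rw [← hhp] at e; exact (MulAction.injective h e).symm)
  -- return times
  have hwp : ∀ n : ℕ, h • g ^ n • z ≠ p := fun n e => by
    have e1 : h • g ^ n • z = h • g ^ n • p := by rw [e, hgpn, hhp]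
    exact hzp (MulAction.injective _ (MulAction.injective h e1))
  have hret : ∀ n : ℕ, ∃ m : ℕ, (g ^ m)⁻¹ • h • g ^ n • z ∈ U := fun n =>
    ((hbwd _ (hwp n)).eventually (hU.mem_nhds hq)).exists
  classical
  let m : ℕ → ℕ := fun n => Nat.find (hret n)
  let D : Set T := Vᶜ ∩ (fun t => g • t) ⁻¹' Uᶜ
  have hDc : IsClosed D := hV.isClosed_compl.inter (hU.isClosed_compl.preimage (continuous_const_smul g))
  have hpD : p ∉ D := fun hh => hh.1 hp
  have hqD : q ∉ D := fun hh => hh.2 (by simpa [hgq] using hq)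
  obtain ⟨E, hE, hEc, hEs⟩ := exists_mem_nhds_isClosed_subset
    (Filter.inter_mem (hDc.isOpen_compl.mem_nhds hqD) (isOpen_compl_singleton.mem_nhds hpq.symm))
  obtain ⟨M, hM⟩ := eventually_atTop.1 ((hbwd _ hhqp).eventually hE)
  have hlim : ∀ k : ℕ, Tendsto (fun n : ℕ => (g ^ k)⁻¹ • h • g ^ n • z) atTop (𝓝 p) := by
    intro k
    have e : p = (g ^ k)⁻¹ • h • p := by rw [hhp, eq_inv_smul_iff, hgpn]
    have := ((hfwd z hzq).const_smul h).const_smul (g ^ k)⁻¹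
    rwa [← e] at this
  have hlarge : ∀ᶠ n in atTop, ∀ k ∈ Set.Iic M, (g ^ k)⁻¹ • h • g ^ n • z ∈ V := by
    rw [eventually_all_finite (Set.finite_Iic M)]
    exact fun k _ => (hlim k).eventually (hV.mem_nhds hp)
  obtain ⟨N, hN⟩ := eventually_atTop.1 hlarge
  have hmM : ∀ n ≥ N, M < m n := by
    intro n hn
    by_contra hcon
    exact Set.disjoint_left.1 hUV (Nat.find_spec (hret n)) (hN n hn (m n) (by simpa using hcon))
  have hmD : ∀ n ≥ N, (g ^ m n)⁻¹ • h • g ^ n • z ∈ D := by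
    intro n hn
    refine ⟨Set.disjoint_left.1 hUV (Nat.find_spec (hret n)), ?_⟩
    obtain ⟨k, hk⟩ := Nat.exists_eq_succ_of_ne_zero (Nat.ne_of_gt (lt_of_le_of_lt (Nat.zero_le _) (hmM n hn)))
    have := Nat.find_min (hret n) (show k < m n by omega)
    simp only [Set.mem_preimage, Set.mem_compl_iff]
    rw [hk, Nat.succ_eq_add_one, pow_succ, mul_inv_rev, mul_smul, smul_inv_smul]
    exact this
  have hfin := finite_trans hd (K := {(p, q, z)}) (L := {p} ×ˢ (E ×ˢ D)) isCompact_singleton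
    (by rintro _ rfl; exact ⟨hpq, hzp.symm, hzq.symm⟩)
    (isCompact_singleton.prod (hEc.isCompact.prod hDc.isCompact))
    (by
      rintro ⟨a, b, c⟩ ⟨ha, hb, hc⟩
      simp only [Set.mem_singleton_iff] at ha hb hc
      subst ha
      refine ⟨fun e => ?_, fun e => ?_, fun e => ?_⟩
      · exact (hEs hb).2 e.symm
      · exact hpD (by simp only at e; rw [e]; exact hc)
      · refine (hEs hb).1 ?_
        simp only at e
        rw [e]; exact hc)
  obtain ⟨n, hn, n', hn', hne, heq⟩ := (Set.Ici_infinite N).exists_ne_map_eq_of_mapsTo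
    (f := fun n => (g ^ m n)⁻¹ * h * g ^ n) (by
      intro n hn
      refine ⟨p, q, z, rfl, ?_, ?_, ?_⟩
      · simp only [mul_smul, hgpn, hhp, Set.mem_singleton_iff, inv_smul_eq_iff]
      · simp only [mul_smul, hgqn]
        exact hM _ (hmM n hn).le
      · simp only [mul_smul]
        exact hmD n hn) hfin
  have hfree : ∀ a b : ℕ, (g ^ a)⁻¹ • h • q = (g ^ b)⁻¹ • h • q → a ≤ b → a = b := by
    intro a b hab hle
    obtain ⟨k, rfl⟩ := Nat.exists_eq_add_of_le hle
    by_contra hk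
    have hk0 : 0 < k := by omega
    have e1 : g ^ k • h • q = h • q := by
      rw [pow_add, mul_inv_rev] at hab
      have hc : (g ^ k)⁻¹ * (g ^ a)⁻¹ = (g ^ a)⁻¹ * (g ^ k)⁻¹ := by
        rw [← mul_inv_rev, ← mul_inv_rev, ← pow_add, ← pow_add, add_comm]
      rw [hc, mul_smul] at hab
      have := MulAction.injective _ hab
      rw [eq_inv_smul_iff] at this
      exact this
    have e2 : ∀ j : ℕ, g ^ (k * j) • h • q = h • q := by
      intro j
      induction j with
      | zero => simp
      | succ j ih => rw [Nat.mul_succ, pow_add, mul_smul, e1, ih]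
    have hl := (hfwd _ hhq).comp (tendsto_id.const_mul_atTop' hk0)
    have hl2 : Tendsto (fun _ : ℕ => h • q) atTop (𝓝 p) := hl.congr e2
    exact hhqp (tendsto_nhds_unique tendsto_const_nhds hl2)
  have hq2 : (g ^ m n)⁻¹ • h • q = (g ^ m n')⁻¹ • h • q := by
    have := congrArg (fun a : G => a • q) heq
    simpa only [mul_smul, hgqn] using this
  have hmm : m n = m n' := by
    rcases le_total (m n) (m n') with hle | hle
    · exact hfree _ _ hq2 hle
    · exact (hfree _ _ hq2.symm hle).symm
  rw [hmm] at heq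
  exact hne (hinj (mul_left_cancel heq))

lemma inter_finite (h3 : HasThreePts T) (hd : ThreeDisc fun (g : G) (x : T) => g • x)
    {p q : T} (hpq : p ≠ q) (hp : ∃ h : G, h • p = p ∧ h • q ≠ q)
    (hq : ∃ h : G, h • q = q ∧ h • p ≠ p) : {g : G | g • p = p ∧ g • q = q}.Finite := by
  by_contra hinf
  have hne : (cofinite ⊓ 𝓟 {g : G | g • p = p ∧ g • q = q} : Filter G).NeBot := by
    rw [← frequently_mem_iff_neBot]
    exact frequently_cofinite_iff_infinite.2 hinf
  let u := Ultrafilter.of (cofinite ⊓ 𝓟 {g : G | g • p = p ∧ g • q = q} : Filter G)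
  have hu : (u : Filter G) ≤ cofinite ⊓ 𝓟 {g : G | g • p = p ∧ g • q = q} := Ultrafilter.of_le _
  have hb : ∀ᶠ g in (u : Filter G), g ∈ {g : G | g • p = p ∧ g • q = q} :=
    hu (mem_inf_of_right (mem_principal_self _))
  have hdyn := dyn h3 hd u id (tendsto_id.mono_left (hu.trans inf_le_left)) hpq (fun _ => p)
    (fun _ => q) tendsto_const_nhds tendsto_const_nhds (hb.mono fun i h => h.1)
    (hb.mono fun i h => h.2)
  obtain ⟨U, V, z, hU, hV, hx, hy, hUV, hzU, hzV⟩ := sepz h3 hpq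
  rcases hdyn with h | h
  · obtain ⟨g, hg, hg'⟩ := ((h U (hU.mem_nhds hx) V (hV.mem_nhds hy)).and hb).exists
    obtain ⟨k, hk, hk'⟩ := hq
    exact hk' (lox h3 hd hU hV hx hy hUV hzU hzV hg'.2 hg'.1 hg hk)
  · obtain ⟨g, hg, hg'⟩ := ((h V (hV.mem_nhds hy) U (hU.mem_nhds hx)).and hb).exists
    obtain ⟨k, hk, hk'⟩ := hp
    exact hk' (lox h3 hd hV hU hy hx hUV.symm hzV hzU hg'.1 hg'.2 hg hk)

end aux

/-- Let `G` be a group admitting a 3-discontinuous and 2-cocompact action on a compactum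
`T`. Then there is a constant `C` such that for every pair of distinct parabolic points
`p, q` one has `|Stab_G p ∩ Stab_G q| ≤ C`. -/
theorem bounded_intersection_of_parabolic_stabilizers {G : Type*} [Group G]
    {T : Type*} [TopologicalSpace T] [CompactSpace T] [T2Space T] (h3 : HasThreePts T)
    (ρ : G → T ≃ₜ T) (hρ : IsTopAction G T ρ)
    (h3d : ThreeDisc fun (g : G) (x : T) => ρ g x)
    (h2c : TwoCocompact fun (g : G) (x : T) => ρ g x) :
    ∃ C : ℕ, ∀ p q : T, IsParabolicPt ρ hρ p → IsParabolicPt ρ hρ q → p ≠ q →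
      ((actStab ρ hρ p : Set G) ∩ (actStab ρ hρ q : Set G)).Finite ∧
      Set.ncard ((actStab ρ hρ p : Set G) ∩ (actStab ρ hρ q : Set G)) ≤ C := by
  letI : MulAction G T :=
    { smul := fun g x => ρ g x
      one_smul := fun x => by
        change ρ 1 x = x
        rw [hρ.map_one]; rfl
      mul_smul := fun a b x => by
        change ρ (a * b) x = ρ a (ρ b x)
        rw [hρ.map_mul]; rfl }
  haveI : ContinuousConstSMul G T := ⟨fun g => (ρ g).continuous⟩
  have hd : ThreeDisc fun (g : G) (x : T) => g • x := h3d
  obtain ⟨K, hK, hK', hc⟩ := h2c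
  obtain ⟨S, hS, hSK⟩ := compact_bound h3 hd hK hK'
  refine ⟨S.ncard, fun p q hp hq hpq => ?_⟩
  have hpar : ∀ a b : T, IsParabolicPt ρ hρ a → b ≠ a → ∃ h : G, h • a = a ∧ h • b ≠ b := by
    intro a b ha hab
    by_contra hcon
    push Not at hcon
    exact hab (ha.2 b fun g hg => hcon g hg)
  have hset : ((actStab ρ hρ p : Set G) ∩ (actStab ρ hρ q : Set G)) =
      {g : G | g • p = p ∧ g • q = q} := rfl
  have hfin := inter_finite h3 hd hpq (hpar p q hp hpq.symm) (hpar q p hq hpq)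
  rw [hset]
  refine ⟨hfin, ?_⟩
  obtain ⟨γ, hγ⟩ := hc (p, q) hpq
  refine Set.ncard_le_ncard_of_injOn (fun g => γ * g * γ⁻¹) ?_ ?_ hS
  · rintro g ⟨hgp, hgq⟩
    have hfo : IsOfFinOrder g := by
      have hpw : ∀ n : ℕ, g ^ n ∈ {g : G | g • p = p ∧ g • q = q} := by
        intro n
        induction n with
        | zero => simp
        | succ n ih =>
          refine ⟨?_, ?_⟩
          · rw [pow_succ, mul_smul, hgp, ih.1]
          · rw [pow_succ, mul_smul, hgq, ih.2]
      by_contra hno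
      exact Set.infinite_of_injective_forall_mem (injective_pow_iff_not_isOfFinOrder.2 hno) hpw hfin
    refine hSK (γ • p, γ • q) hγ _ ?_ ?_ ?_
    · simp only [mul_smul, inv_smul_smul, hgp]
    · simp only [mul_smul, inv_smul_smul, hgq]
    · simpa [MulAut.conj_apply] using (MulAut.conj γ).toMonoidHom.isOfFinOrder hfo
  · intro a _ b _ hab
    simpa using hab

end RHG
end
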